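/- For every integer n ≥ 1, the number of symmetric Dellac configurations of size 2n equals 2·P_n(2), i.e., |SDC_{2n}| = 2·P_n(2). -/

import Mathlib

open scoped Classical

namespace SymDellac

/-- The polynomials `P n` (for `n ≥ 1`) defined by `P 1 = 1` and
`P (n+1) (x) = ((x+2)(x+1)/2) P n (x+2) - (x(x-1)/2) P n (x)`. -/
noncomputable def P : ℕ → Polynomial ℚ
  | 0 => 1
  | 1 => 1
  | n + 2 =>
      Polynomial.C (1/2 : ℚ) *
        ((Polynomial.X + 2) * (Polynomial.X + 1) * ((P (n+1)).comp (Polynomial.X + 2))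
          - Polynomial.X * (Polynomial.X - 1) * (P (n+1)))

/-- The polynomials `D n` defined by `D 0 = 1` and
`D (n+1) (x) = (x+1)(x+2) D n (x+2) - x(x+1) D n (x)`. -/
noncomputable def D : ℕ → Polynomial ℚ
  | 0 => 1
  | n + 1 =>
      (Polynomial.X + 1) * (Polynomial.X + 2) * ((D n).comp (Polynomial.X + 2))
        - Polynomial.X * (Polynomial.X + 1) * (D n)

/-! ### Even extended Dellac configurations -/

/-- `T` is an even extended Dellac configuration of size `n`. -/
def IsTne (n : ℕ) (T : Finset (ℕ × ℕ)) : Prop :=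
  (∀ p ∈ T, 1 ≤ p.1 ∧ p.1 ≤ n ∧ 1 ≤ p.2 ∧ p.2 ≤ 2*n ∧ p.1 ≤ p.2) ∧
  (∀ i ∈ Finset.Icc 1 (2*n), (T.filter (fun p => p.2 = i)).card = 1) ∧
  (∀ j ∈ Finset.Icc 1 n, (T.filter (fun p => p.1 = j)).card = 2)

/-- The finite set of even extended Dellac configurations of size `n`. -/
noncomputable def TneF (n : ℕ) : Finset (Finset (ℕ × ℕ)) :=
  ((Finset.Icc 1 n ×ˢ Finset.Icc 1 (2*n)).powerset).filter (IsTne n)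

/-- Number of free points of an even extended Dellac configuration. -/
def frE (n : ℕ) (T : Finset (ℕ × ℕ)) : ℕ :=
  (T.filter (fun p => 2*n + 1 ≤ p.2 + p.1)).card

/-- The (unique) point of `T` in row `r` (junk value if there is none). -/
noncomputable def rowPt (T : Finset (ℕ × ℕ)) (r : ℕ) : ℕ × ℕ :=
  if h : ∃ p ∈ T, p.2 = r then h.choose else (0, 0)

/-- `p` is the upper of the two points of its column in `T`. -/
def IsUpper (T : Finset (ℕ × ℕ)) (p : ℕ × ℕ) : Prop :=
  ∃ q ∈ T, q.1 = p.1 ∧ q.2 < p.2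

/-- One step of the path of Definition 1.2 (even case). -/
noncomputable def stepE (n : ℕ) (T : Finset (ℕ × ℕ)) (p : ℕ × ℕ) : ℕ × ℕ :=
  if p.1 = n then p
  else if IsUpper T p then rowPt T (2*n - p.1) else rowPt T p.1

/-- The path `(p_0, p_1, …)` starting at the point of row `i` (even case). -/
noncomputable def pathE (n : ℕ) (T : Finset (ℕ × ℕ)) (i k : ℕ) : ℕ × ℕ :=
  (stepE n T)^[k] (rowPt T i)

/-- The set of points of the subsequence `S_T(i)` of strict column records. -/
noncomputable def recSetE (n : ℕ) (T : Finset (ℕ × ℕ)) (i : ℕ) : Set (ℕ × ℕ) :=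
  {p | ∃ k, pathE n T i k = p ∧ ∀ k' < k, (pathE n T i k').1 < p.1}

/-- `b(T)`: `B(T) = S_T(n)` has `b(T) + 1` elements. -/
noncomputable def bStat (n : ℕ) (T : Finset (ℕ × ℕ)) : ℕ := (recSetE n T n).ncard - 1

/-- `r(T)`: `R(T) = S_T(2n)` has `r(T) + 1` elements. -/
noncomputable def rStat (n : ℕ) (T : Finset (ℕ × ℕ)) : ℕ := (recSetE n T (2*n)).ncard - 1

/-- Row of the upper point of column `c` of `T`. -/
noncomputable def upRow (T : Finset (ℕ × ℕ)) (c : ℕ) : ℕ := sSup {i | (c, i) ∈ T}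

/-- Row of the lower point of column `c` of `T`. -/
noncomputable def lowRow (T : Finset (ℕ × ℕ)) (c : ℕ) : ℕ := sInf {i | (c, i) ∈ T}

/-- One step of the root sequence `I_T(j,i)`, in a tableau with `R` rows. -/
noncomputable def rStep (R j : ℕ) (T : Finset (ℕ × ℕ)) (x : ℕ) : ℕ :=
  if (j ≤ x ∧ x ≤ R - j) ∨ x = R then x
  else if R - j + 1 ≤ x ∧ x ≤ R - 1 then upRow T (R - x)
  else lowRow T x

/-- `root_T(j,i)`: the eventual constant value of the sequence `I_T(j,i)`
(junk value `0` if the sequence is not eventually constant). -/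
noncomputable def rootVal (R j : ℕ) (T : Finset (ℕ × ℕ)) (i : ℕ) : ℕ :=
  if h : ∃ v, ∃ N, ∀ k ≥ N, (rStep R j T)^[k] i = v then h.choose else 0

/-- The set `G(T)` for an even extended Dellac configuration. -/
noncomputable def GsetE (n : ℕ) (T : Finset (ℕ × ℕ)) : Set (ℕ × ℕ) :=
  {p | p ∈ T ∧ 2*n + 1 ≤ p.2 + p.1 ∧
    (∃ q ∈ T, q.1 = p.1 ∧ q ≠ p ∧ q ∈ recSetE n T n) ∧ rootVal (2*n) p.1 T p.2 = p.1}

/-- `g(T) = |G(T)|`. -/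
noncomputable def gStat (n : ℕ) (T : Finset (ℕ × ℕ)) : ℕ := (GsetE n T).ncard

/-- `max(T) = b(T) + r(T) + g(T)`. -/
noncomputable def maxStat (n : ℕ) (T : Finset (ℕ × ℕ)) : ℕ :=
  bStat n T + rStat n T + gStat n T

/-! ### Odd extended Dellac configurations -/

/-- `T` is an odd extended Dellac configuration of size `n`. -/
def IsTno (n : ℕ) (T : Finset (ℕ × ℕ)) : Prop :=
  (∀ p ∈ T, 1 ≤ p.1 ∧ p.1 ≤ n ∧ 1 ≤ p.2 ∧ p.2 ≤ 2*n+1 ∧ p.1 ≤ p.2) ∧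
  (∀ i : ℕ, (T.filter (fun p => p.2 = i)).card ≤ 1) ∧
  (∀ i ∈ Finset.Icc 1 n, (T.filter (fun p => p.2 = i)).card = 1) ∧
  (∀ j ∈ Finset.Icc 1 n, (T.filter (fun p => p.1 = j)).card = 2)

/-- The finite set of odd extended Dellac configurations of size `n`. -/
noncomputable def TnoF (n : ℕ) : Finset (Finset (ℕ × ℕ)) :=
  ((Finset.Icc 1 n ×ˢ Finset.Icc 1 (2*n+1)).powerset).filter (IsTno n)

/-- Number of free points of an odd extended Dellac configuration. -/
def frO (n : ℕ) (T : Finset (ℕ × ℕ)) : ℕ :=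
  (T.filter (fun p => 2*n + 2 ≤ p.2 + p.1)).card

/-- One step of the path (odd case): if the required row is empty, stay put. -/
noncomputable def stepO (n : ℕ) (T : Finset (ℕ × ℕ)) (p : ℕ × ℕ) : ℕ × ℕ :=
  if p.1 = n then p
  else
    let r : ℕ := if IsUpper T p then 2*n + 1 - p.1 else p.1
    if ∃ q ∈ T, q.2 = r then rowPt T r else p

/-- The path `(p_0, p_1, …)` starting at the point of row `i` (odd case). -/
noncomputable def pathO (n : ℕ) (T : Finset (ℕ × ℕ)) (i k : ℕ) : ℕ × ℕ :=
  (stepO n T)^[k] (rowPt T i)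

/-- The set of points of `V(T) = S_T(2n+1)` (empty if row `2n+1` is empty). -/
noncomputable def Vset (n : ℕ) (T : Finset (ℕ × ℕ)) : Set (ℕ × ℕ) :=
  if ∃ p ∈ T, p.2 = 2*n + 1 then
    {p | ∃ k, pathO n T (2*n+1) k = p ∧ ∀ k' < k, (pathO n T (2*n+1) k').1 < p.1}
  else ∅

/-- `v(T)`: the number of elements of `V(T)`. -/
noncomputable def vStat (n : ℕ) (T : Finset (ℕ × ℕ)) : ℕ := (Vset n T).ncard

/-- The set `G(T)` for an odd extended Dellac configuration. -/
noncomputable def GsetO (n : ℕ) (T : Finset (ℕ × ℕ)) : Set (ℕ × ℕ) :=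
  {p | p ∈ T ∧ 2*n + 2 ≤ p.2 + p.1 ∧
    (∃ q ∈ T, q.1 = p.1 ∧ q ≠ p ∧ q ∈ Vset n T) ∧ rootVal (2*n+1) p.1 T p.2 = p.1}

/-- `g(T) = |G(T)|` (odd case). -/
noncomputable def gStatO (n : ℕ) (T : Finset (ℕ × ℕ)) : ℕ := (GsetO n T).ncard

/-! ### Dellac configurations and symmetric Dellac configurations -/

/-- `D` is a Dellac configuration of size `N`. -/
def IsDC (N : ℕ) (D : Finset (ℕ × ℕ)) : Prop :=
  (∀ p ∈ D, 1 ≤ p.1 ∧ p.1 ≤ N ∧ 1 ≤ p.2 ∧ p.2 ≤ 2*N ∧ p.1 ≤ p.2 ∧ p.2 ≤ N + p.1) ∧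
  (∀ i ∈ Finset.Icc 1 (2*N), (D.filter (fun p => p.2 = i)).card = 1) ∧
  (∀ j ∈ Finset.Icc 1 N, (D.filter (fun p => p.1 = j)).card = 2)

/-- `D` is a symmetric Dellac configuration of size `N`. -/
def IsSDC (N : ℕ) (D : Finset (ℕ × ℕ)) : Prop :=
  IsDC N D ∧ ∀ p ∈ D, (N + 1 - p.1, 2*N + 1 - p.2) ∈ D

/-- The finite set of symmetric Dellac configurations of size `N`. -/
noncomputable def SDCF (N : ℕ) : Finset (Finset (ℕ × ℕ)) :=
  ((Finset.Icc 1 N ×ˢ Finset.Icc 1 (2*N)).powerset).filter (IsSDC N)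

/-! ### Surjective pistols -/

/-- `p` encodes a surjective pistol of size `n`: position `k` stands for `k+1 ∈ {1,…,2n}`
and value `p k` stands for `(p k) + 1 ∈ {2,4,…,2n}`. -/
def IsSP (n : ℕ) (p : Fin (2*n) → Fin (2*n)) : Prop :=
  (∀ k, Even ((p k : ℕ) + 1) ∧ (k : ℕ) ≤ (p k : ℕ)) ∧
  (∀ m : Fin (2*n), Even ((m : ℕ) + 1) → ∃ k, p k = m)

/-- The finite set of surjective pistols of size `n`. -/
noncomputable def SPF (n : ℕ) : Finset (Fin (2*n) → Fin (2*n)) :=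
  Finset.univ.filter (IsSP n)

/-- `max(f)`: the number of `j ∈ {1,…,2n-2}` with `f(j) = 2n`. -/
noncomputable def maxP (n : ℕ) (p : Fin (2*n) → Fin (2*n)) : ℕ :=
  (Finset.univ.filter (fun k : Fin (2*n) => (k : ℕ) + 1 ≤ 2*n - 2 ∧ (p k : ℕ) + 1 = 2*n)).card

/-- `fd(f)`: the number of doubled fixed points of `f`. -/
noncomputable def fdP (n : ℕ) (p : Fin (2*n) → Fin (2*n)) : ℕ :=
  (Finset.univ.filter (fun k : Fin (2*n) =>
    (k : ℕ) + 1 ≤ 2*n - 2 ∧ (p k : ℕ) = (k : ℕ) ∧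
      ∃ k' : Fin (2*n), (k' : ℕ) < (k : ℕ) ∧ p k' = p k)).card

end SymDellac
/-! ### More constructions -/

namespace SymDellac

/-- `e_{n,k} = Σ_{T ∈ T_n^e, max(T) = k} 2^{fr(T) - 1 - k}`. -/
noncomputable def eStat (n k : ℕ) : ℕ :=
  ∑ T ∈ (TneF n).filter (fun T => maxStat n T = k), 2 ^ (frE n T - 1 - k)

/-- The configuration `T_{n,max}` with points `(j,j)` and `(j, 2n+1-j)` for `j ∈ [n]`. -/
def Tmax (n : ℕ) : Finset (ℕ × ℕ) :=
  (Finset.Icc 1 n).image (fun j => (j, j)) ∪ (Finset.Icc 1 n).image (fun j => (j, 2*n + 1 - j))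

/-- The index of the (unique) empty row of an odd extended Dellac configuration. -/
noncomputable def emptyRowIdx (n : ℕ) (T : Finset (ℕ × ℕ)) : ℕ :=
  sInf {i | 1 ≤ i ∧ i ≤ 2*n + 1 ∧ ∀ p ∈ T, p.2 ≠ i}

/-- The map `φ : T_n^o → T_n^e` deleting the empty row. -/
noncomputable def phi (n : ℕ) (T : Finset (ℕ × ℕ)) : Finset (ℕ × ℕ) :=
  T.image (fun p => if emptyRowIdx n T < p.2 then (p.1, p.2 - 1) else p)

/-- `Omax(T)`: the set of all points of `B(T)`, `R(T)` and `G(T)`. -/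
noncomputable def OmaxE (n : ℕ) (T : Finset (ℕ × ℕ)) : Set (ℕ × ℕ) :=
  recSetE n T n ∪ recSetE n T (2*n) ∪ GsetE n T

/-- Insertion of a point in the box `(j, r)` of a tableau `U` with `R` rows:
add the point `(j, i₀)` where `i₀` is the (unique) row with no point of `U`
in columns `1,…,j-1` whose root equals `r`. -/
noncomputable def insertPt (R j r : ℕ) (U : Finset (ℕ × ℕ)) : Finset (ℕ × ℕ) :=
  if h : ∃ i0, j ≤ i0 ∧ i0 ≤ R ∧ (∀ p ∈ U, p.2 = i0 → j ≤ p.1) ∧ rootVal R j U i0 = r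
  then insert (j, h.choose) U else U

/-- One step (column `j`) of the construction of `P(T)`. -/
noncomputable def Pstep (n : ℕ) (T : Finset (ℕ × ℕ)) (U : Finset (ℕ × ℕ)) (j : ℕ) :
    Finset (ℕ × ℕ) :=
  let U1 := if ∃ p ∈ T, p.1 = j ∧ p ∈ recSetE n T n ∪ recSetE n T (2*n)
    then insertPt (2*n - 1) j (2*n - 1) U else U
  if ∃ p ∈ T, p.1 = j ∧ p ∈ GsetE n T then insertPt (2*n - 1) j j U1 else U1

/-- The map `P : T_n^e → T_{n-1}^o`. -/
noncomputable def Pmap (n : ℕ) (T : Finset (ℕ × ℕ)) : Finset (ℕ × ℕ) :=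
  (List.range' 1 (n-1)).foldl (Pstep n T)
    ((T.filter (fun p => p ∉ OmaxE n T)).image
      (fun p => (p.1, if p.2 < n then p.2 else p.2 - 1)))

end SymDellac

namespace SymDellac

/-- Sum of the variables of index at least `a`. -/
noncomputable def tailSum (n a : ℕ) : MvPolynomial (Fin n) ℚ :=
  ∑ j : Fin n, if a ≤ (j : ℕ) then MvPolynomial.X j else 0

/-- The operator on functions underlying the recursion of `P`. -/
def recStep (p : ℕ → ℚ) (x : ℕ) : ℚ :=
  ((x + 2).choose 2 : ℚ) * p (x + 2) - (x.choose 2 : ℚ) * p x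

/-- Evaluation of a polynomial at `s`, the coefficient of degree `x` being weighted by `p x`. -/
noncomputable def weightedEval {A : Type*} [CommRing A] [Algebra ℚ A] (p : ℕ → ℚ) (s : A) :
    Polynomial A →ₗ[A] A :=
  Polynomial.lsum fun x => LinearMap.mulRight A (algebraMap ℚ A (p x) * s ^ x)

theorem weightedEval_monomial {A : Type*} [CommRing A] [Algebra ℚ A] (p : ℕ → ℚ) (s c : A)
    (x : ℕ) : weightedEval p s (Polynomial.monomial x c) = c * (algebraMap ℚ A (p x) * s ^ x) := by
  simp [weightedEval, Polynomial.lsum_apply, mul_assoc]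

theorem weightedEval_one {A : Type*} [CommRing A] [Algebra ℚ A] (s : A) (f : Polynomial A) :
    weightedEval (fun _ => 1) s f = f.eval s := by
  induction f using Polynomial.induction_on' with
  | add f g hf hg => simp [hf, hg]
  | monomial x c => simp [weightedEval_monomial]

theorem tailSum_succ_succ (n a : ℕ) :
    tailSum (n + 1) (a + 1) = MvPolynomial.rename Fin.succ (tailSum n a) := by
  simp only [tailSum, Fin.sum_univ_succ, map_sum]
  simp [apply_ite (MvPolynomial.rename Fin.succ)]

theorem tailSum_succ_zero (n : ℕ) :
    tailSum (n + 1) 0 = MvPolynomial.X 0 + MvPolynomial.rename Fin.succ (tailSum n 0) := by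
  simp [tailSum, Fin.sum_univ_succ]

theorem tailSum_self (n : ℕ) : tailSum n n = 0 := by
  refine Finset.sum_eq_zero fun j _ => ?_
  rw [if_neg (by omega)]

theorem coeff_cons_weightedEval (n : ℕ) (m : Fin n →₀ ℕ) (p : ℕ → ℚ)
    (G : Polynomial (MvPolynomial (Fin n) ℚ)) :
    MvPolynomial.coeff (m.cons 2) (weightedEval p (tailSum (n + 1) 0)
      (((Polynomial.X ^ 2 - Polynomial.C (tailSum n 0 ^ 2)) * G).map
        (MvPolynomial.rename Fin.succ : _ →ₐ[ℚ] MvPolynomial (Fin (n + 1)) ℚ).toRingHom)) =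
    MvPolynomial.coeff m (weightedEval (recStep p) (tailSum n 0) G) := by
  induction G using Polynomial.induction_on' with
  | add f g hf hg => simp only [mul_add, Polynomial.map_add, map_add, MvPolynomial.coeff_add, hf, hg]
  | monomial x c =>
    rw [← MvPolynomial.finSuccEquiv_coeff_coeff]
    have h1 : (Polynomial.X ^ 2 - Polynomial.C (tailSum n 0 ^ 2)) * Polynomial.monomial x c =
        Polynomial.monomial (x + 2) c - Polynomial.monomial x (tailSum n 0 ^ 2 * c) := by
      rw [sub_mul, Polynomial.C_mul_monomial, mul_comm, Polynomial.monomial_mul_X_pow]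
    have h4 (q : ℚ) : MvPolynomial.finSuccEquiv ℚ n (algebraMap ℚ _ q) =
        Polynomial.C (algebraMap ℚ _ q) := by
      rw [AlgEquiv.commutes]; rfl
    have h2 (d : MvPolynomial (Fin n) ℚ) :
        MvPolynomial.finSuccEquiv ℚ n (MvPolynomial.rename Fin.succ d) = Polynomial.C d := by
      induction d using MvPolynomial.induction_on with
      | C a => rw [MvPolynomial.rename_C]; exact h4 a
      | add f g hf hg => simp only [map_add, hf, hg]
      | mul_X f j hf =>
        simp only [map_mul, hf, MvPolynomial.rename_X, MvPolynomial.finSuccEquiv_X_succ]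
    have h3 : MvPolynomial.finSuccEquiv ℚ n (tailSum (n + 1) 0) =
        Polynomial.X + Polynomial.C (tailSum n 0) := by
      rw [tailSum_succ_zero, map_add, h2, MvPolynomial.finSuccEquiv_X_zero]
    rw [h1]
    simp only [Polynomial.map_sub, Polynomial.map_monomial, map_sub, weightedEval_monomial,
      map_mul, map_pow, h3, h4, AlgHom.toRingHom_eq_coe, RingHom.coe_coe, h2]
    simp only [mul_assoc, ← Polynomial.C_pow, Polynomial.coeff_sub, Polynomial.coeff_C_mul,
      Polynomial.coeff_X_add_C_pow]
    congr 1
    rcases x with _ | _ | x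
    · simp [recStep]
    · simp [recStep, map_ofNat]; ring_nf; simp
    · simp [recStep]; ring

theorem coeff_two_weightedEval (n : ℕ) (p : ℕ → ℚ) :
    MvPolynomial.coeff (Finsupp.equivFunOnFinite.symm fun _ => 2) (weightedEval p (tailSum n 0)
      (∏ a ∈ Finset.range n, (Polynomial.X ^ 2 - Polynomial.C (tailSum n (a + 1) ^ 2)))) =
    (recStep^[n] p) 0 := by
  induction n generalizing p with
  | zero =>
    rw [Finset.prod_range_zero, ← Polynomial.monomial_zero_one, weightedEval_monomial]
    have : (Finsupp.equivFunOnFinite.symm fun _ => 2 : Fin 0 →₀ ℕ) = 0 := Subsingleton.elim _ _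
    simp [this]
  | succ n ih =>
    have hm : (Finsupp.equivFunOnFinite.symm fun _ => 2 : Fin (n + 1) →₀ ℕ) =
        (Finsupp.equivFunOnFinite.symm fun _ => 2 : Fin n →₀ ℕ).cons 2 := by
      ext i
      refine Fin.cases ?_ (fun j => ?_) i <;> simp
    rw [Function.iterate_succ_apply, ← ih, hm, ← coeff_cons_weightedEval, Finset.prod_range_succ']
    simp only [tailSum_succ_succ]
    rw [mul_comm]
    simp [Polynomial.map_prod]

theorem P_succ_eval (n x : ℕ) : (P (n + 1)).eval (x : ℚ) = (recStep^[n] fun _ => 1) x := by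
  induction n generalizing x with
  | zero => simp [P]
  | succ n ih =>
    rw [Function.iterate_succ_apply', recStep, ← ih, ← ih, Nat.cast_choose_two,
      Nat.cast_choose_two, P]
    push_cast
    simp
    ring

/-! ### Symmetric configurations as functions -/

/-- Position of an index, the second copy being placed after the first one, in reverse order. -/
def pos {n : ℕ} : Fin n ⊕ Fin n → ℕ
  | .inl a => a
  | .inr a => 2 * n - 1 - a

theorem pos_lt {n : ℕ} (u : Fin n ⊕ Fin n) : pos u < 2 * n := by
  rcases u with a | a <;> simp only [pos] <;> omega

theorem pos_swap {n : ℕ} (u : Fin n ⊕ Fin n) : pos u.swap = 2 * n - 1 - pos u := by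
  rcases u with a | a <;> simp only [pos, Sum.swap_inl, Sum.swap_inr]
  omega

theorem pos_injective {n : ℕ} : Function.Injective (pos (n := n)) := by
  rintro (a | a) (b | b) h <;> simp only [pos] at h
  · exact congrArg _ (Fin.ext h)
  · omega
  · omega
  · exact congrArg _ (Fin.ext (by omega))

theorem exists_pos_eq {n k : ℕ} (hk : k < 2 * n) : ∃ u : Fin n ⊕ Fin n, pos u = k := by
  by_cases h : k < n
  · exact ⟨.inl ⟨k, h⟩, rfl⟩
  · exact ⟨.inr ⟨2 * n - 1 - k, by omega⟩, by simp only [pos]; omega⟩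

/-- The index of the pair of opposite columns containing a given column. -/
def fold {n : ℕ} : Fin n ⊕ Fin n → Fin n := Sum.elim id id

theorem fold_eq_fold {n : ℕ} (u v : Fin n ⊕ Fin n) : fold u = fold v ↔ u = v ∨ u = v.swap := by
  rcases u with a | a <;> rcases v with b | b <;> simp [fold]

/-- Choices of the columns of the points in the first half of the rows of a symmetric Dellac
configuration of size `2 * n`. -/
def IsHalf (n : ℕ) (c : Fin n ⊕ Fin n → Fin n ⊕ Fin n) : Prop :=
  (∀ i, pos (c i) ≤ pos i) ∧ ∀ j, (Finset.univ.filter fun i => fold (c i) = j).card = 2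

/-- The symmetric set of points built from the first half of its rows. -/
noncomputable def unfold {n : ℕ} (c : Fin n ⊕ Fin n → Fin n ⊕ Fin n) : Finset (ℕ × ℕ) :=
  Finset.univ.image (fun i => (pos (c i) + 1, pos i + 1)) ∪
    Finset.univ.image (fun i => (2 * n - pos (c i), 4 * n - pos i))

theorem mem_unfold {n : ℕ} {c : Fin n ⊕ Fin n → Fin n ⊕ Fin n} {p : ℕ × ℕ} :
    p ∈ unfold c ↔ (∃ i, (pos (c i) + 1, pos i + 1) = p) ∨
      ∃ i, (2 * n - pos (c i), 4 * n - pos i) = p := by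
  simp [unfold]

theorem card_unfold_col {n : ℕ} (c : Fin n ⊕ Fin n → Fin n ⊕ Fin n) (u : Fin n ⊕ Fin n) :
    ((unfold c).filter fun p => p.1 = pos u + 1).card =
      (Finset.univ.filter fun i => fold (c i) = fold u).card := by
  have h1 : (unfold c).filter (fun p => p.1 = pos u + 1) =
      (Finset.univ.filter fun i => c i = u).image (fun i => (pos (c i) + 1, pos i + 1)) ∪
      (Finset.univ.filter fun i => c i = u.swap).image
        (fun i => (2 * n - pos (c i), 4 * n - pos i)) := by
    ext p
    simp only [Finset.mem_filter, mem_unfold, Finset.mem_union, Finset.mem_image,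
      Finset.mem_univ, true_and]
    have hu := pos_lt u
    constructor
    · rintro ⟨⟨i, rfl⟩ | ⟨i, rfl⟩, h⟩
      · exact .inl ⟨i, pos_injective (by simpa using h), rfl⟩
      · refine .inr ⟨i, pos_injective ?_, rfl⟩
        have := pos_lt (c i)
        rw [pos_swap]
        dsimp only at h
        omega
    · rintro (⟨i, hi, rfl⟩ | ⟨i, hi, rfl⟩)
      · exact ⟨.inl ⟨i, rfl⟩, by rw [hi]⟩
      · refine ⟨.inr ⟨i, rfl⟩, ?_⟩
        have := pos_swap u
        dsimp only
        rw [hi]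
        omega
  have h2 : (Finset.univ.filter fun i => fold (c i) = fold u) =
      (Finset.univ.filter fun i => c i = u) ∪ Finset.univ.filter fun i => c i = u.swap := by
    ext i
    simp [fold_eq_fold]
  have hs : u ≠ u.swap := by rcases u with a | a <;> simp
  rw [h1, h2, Finset.card_union_of_disjoint, Finset.card_union_of_disjoint,
    Finset.card_image_of_injective, Finset.card_image_of_injective]
  · intro i j hij
    have h := (Prod.ext_iff.1 hij).2
    have := pos_lt i
    have := pos_lt j
    dsimp only at h
    exact pos_injective (by omega)
  · intro i j hij
    have h := (Prod.ext_iff.1 hij).2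
    dsimp only at h
    exact pos_injective (by omega)
  · rw [Finset.disjoint_filter]
    exact fun i _ h h' => hs (h.symm.trans h')
  · rw [Finset.disjoint_left]
    simp only [Finset.mem_image]
    rintro p ⟨i, -, rfl⟩ ⟨j, -, hj⟩
    have h := (Prod.ext_iff.1 hj).2
    have := pos_lt i
    have := pos_lt j
    dsimp only at h
    omega

theorem unfold_row {n : ℕ} (c : Fin n ⊕ Fin n → Fin n ⊕ Fin n) (i : Fin n ⊕ Fin n) {x : ℕ}
    (h : (x, pos i + 1) ∈ unfold c) : x = pos (c i) + 1 := by
  have := pos_lt i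
  rcases mem_unfold.1 h with ⟨j, hj⟩ | ⟨j, hj⟩ <;> rw [Prod.ext_iff] at hj <;> dsimp only at hj
  · rw [pos_injective (a₁ := i) (a₂ := j) (by omega), hj.1]
  · have := pos_lt j
    omega

theorem unfold_injective {n : ℕ} : Function.Injective (unfold (n := n)) := by
  intro c d h
  funext i
  have hi : (pos (c i) + 1, pos i + 1) ∈ unfold d := h ▸ mem_unfold.2 (.inl ⟨i, rfl⟩)
  exact pos_injective (by simpa using unfold_row d i hi)

theorem unfold_symm {n : ℕ} {c : Fin n ⊕ Fin n → Fin n ⊕ Fin n} {p : ℕ × ℕ}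
    (hp : p ∈ unfold c) : (2 * n + 1 - p.1, 4 * n + 1 - p.2) ∈ unfold c := by
  rcases mem_unfold.1 hp with ⟨i, rfl⟩ | ⟨i, rfl⟩ <;> rw [mem_unfold]
  · exact .inr ⟨i, by ext <;> dsimp only <;> omega⟩
  · have := pos_lt i
    have := pos_lt (c i)
    exact .inl ⟨i, by ext <;> dsimp only <;> omega⟩

theorem isSDC_unfold {n : ℕ} {c : Fin n ⊕ Fin n → Fin n ⊕ Fin n} (hc : IsHalf n c) :
    IsSDC (2 * n) (unfold c) := by
  refine ⟨⟨fun p hp => ?_, fun r hr => ?_, fun j hj => ?_⟩, fun p hp => ?_⟩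
  · rcases mem_unfold.1 hp with ⟨i, rfl⟩ | ⟨i, rfl⟩
    all_goals
      have := pos_lt i
      have := pos_lt (c i)
      have := hc.1 i
      dsimp only
      omega
  · rw [Finset.mem_Icc] at hr
    rw [Finset.card_eq_one]
    by_cases h : r ≤ 2 * n
    · obtain ⟨i, hi⟩ := exists_pos_eq (n := n) (k := r - 1) (by omega)
      obtain rfl : r = pos i + 1 := by omega
      refine ⟨(pos (c i) + 1, pos i + 1), ?_⟩
      rw [Finset.eq_singleton_iff_unique_mem, Finset.mem_filter]
      refine ⟨⟨mem_unfold.2 (.inl ⟨i, rfl⟩), rfl⟩, ?_⟩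
      rintro ⟨x, y⟩ hp
      obtain ⟨hp, rfl⟩ := Finset.mem_filter.1 hp
      rw [unfold_row c i hp]
    · obtain ⟨i, hi⟩ := exists_pos_eq (n := n) (k := 4 * n - r) (by omega)
      obtain rfl : r = 4 * n - pos i := by omega
      refine ⟨(2 * n - pos (c i), 4 * n - pos i), ?_⟩
      rw [Finset.eq_singleton_iff_unique_mem, Finset.mem_filter]
      refine ⟨⟨mem_unfold.2 (.inr ⟨i, rfl⟩), rfl⟩, ?_⟩
      rintro ⟨x, y⟩ hp
      obtain ⟨hp, hy⟩ := Finset.mem_filter.1 hp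
      dsimp only at hy
      rcases mem_unfold.1 hp with ⟨j, hj⟩ | ⟨j, hj⟩ <;> have := pos_lt j <;>
        rw [Prod.ext_iff] at hj <;> dsimp only at hj
      · omega
      · obtain rfl : i = j := pos_injective (by omega)
        rw [← hj.1, hy]
  · rw [Finset.mem_Icc] at hj
    obtain ⟨u, hu⟩ := exists_pos_eq (n := n) (k := j - 1) (by omega)
    obtain rfl : j = pos u + 1 := by omega
    rw [card_unfold_col]
    exact hc.2 _
  · have := unfold_symm hp
    rwa [show 2 * (2 * n) = 4 * n by omega]

theorem exists_unfold_eq {n : ℕ} {D : Finset (ℕ × ℕ)} (hD : IsSDC (2 * n) D) :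
    ∃ c, IsHalf n c ∧ unfold c = D := by
  obtain ⟨⟨hbox, hrow, hcol⟩, hsymm⟩ := hD
  have huniq : ∀ p ∈ D, ∀ q ∈ D, p.2 = q.2 → p = q := by
    intro p hp q hq h
    have hb := hbox p hp
    refine Finset.card_le_one.1 (hrow p.2 (by rw [Finset.mem_Icc]; omega)).le p ?_ q ?_ <;>
      simp [hp, hq, h]
  have hex : ∀ i : Fin n ⊕ Fin n, ∃ u : Fin n ⊕ Fin n, (pos u + 1, pos i + 1) ∈ D := by
    intro i
    have hi := pos_lt i
    obtain ⟨⟨x, y⟩, hp⟩ := Finset.card_pos.1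
      (by rw [hrow (pos i + 1) (by rw [Finset.mem_Icc]; omega)]; exact one_pos)
    obtain ⟨hp, rfl⟩ := Finset.mem_filter.1 hp
    have hb := hbox _ hp
    dsimp only at hb
    obtain ⟨u, hu⟩ := exists_pos_eq (n := n) (k := x - 1) (by omega)
    exact ⟨u, by rwa [hu, Nat.sub_add_cancel hb.1]⟩
  choose c hc using hex
  have heq : unfold c = D := by
    ext p
    constructor
    · intro hp
      rcases mem_unfold.1 hp with ⟨i, rfl⟩ | ⟨i, rfl⟩
      · exact hc i
      · convert hsymm _ (hc i) using 2 <;> dsimp only <;> omega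
    · intro hp
      have key : ∀ p ∈ D, p.2 ≤ 2 * n → p ∈ unfold c := by
        intro p hp h
        have hb := hbox p hp
        obtain ⟨i, hi⟩ := exists_pos_eq (n := n) (k := p.2 - 1) (by omega)
        exact mem_unfold.2 (.inl ⟨i, huniq _ (hc i) _ hp (by dsimp only; omega)⟩)
      by_cases h : p.2 ≤ 2 * n
      · exact key p hp h
      · have hb := hbox p hp
        convert unfold_symm (key _ (hsymm p hp) (by dsimp only; omega)) using 1
        ext <;> dsimp only <;> omega
  refine ⟨c, ⟨fun i => ?_, fun j => ?_⟩, heq⟩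
  · have := hbox _ (hc i)
    dsimp only at this
    omega
  · have := card_unfold_col c (.inl j)
    rw [heq, hcol _ (by simp only [pos, Finset.mem_Icc]; omega)] at this
    exact this.symm

theorem card_SDCF (n : ℕ) :
    (SDCF (2 * n)).card = (Finset.univ.filter fun c => IsHalf n c).card := by
  symm
  refine Finset.card_bij (fun c _ => unfold c) (fun c hc => ?_)
    (fun c _ d _ h => unfold_injective h) (fun D hD => ?_)
  · have h := isSDC_unfold (Finset.mem_filter.1 hc).2
    refine Finset.mem_filter.2 ⟨Finset.mem_powerset.2 fun p hp => ?_, h⟩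
    have := h.1.1 p hp
    simp only [Finset.mem_product, Finset.mem_Icc]
    omega
  · obtain ⟨c, hc, rfl⟩ := exists_unfold_eq (Finset.mem_filter.1 hD).2
    exact ⟨c, Finset.mem_filter.2 ⟨Finset.mem_univ _, hc⟩, rfl⟩

/-! ### The generating polynomial -/

theorem card_isHalf (n : ℕ) :
    ((Finset.univ.filter fun c => IsHalf n c).card : ℚ) =
      MvPolynomial.coeff (Finsupp.equivFunOnFinite.symm fun _ => 2)
        (∏ i : Fin n ⊕ Fin n, ∑ u ∈ Finset.univ.filter fun u => pos u ≤ pos i,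
          (MvPolynomial.X (fold u) : MvPolynomial (Fin n) ℚ)) := by
  rw [Finset.prod_univ_sum, MvPolynomial.coeff_sum]
  have h (c : Fin n ⊕ Fin n → Fin n ⊕ Fin n) :
      MvPolynomial.coeff (Finsupp.equivFunOnFinite.symm fun _ => 2)
        (∏ i, (MvPolynomial.X (fold (c i)) : MvPolynomial (Fin n) ℚ)) =
      if ∀ j, (Finset.univ.filter fun i => fold (c i) = j).card = 2 then 1 else 0 := by
    have : ∏ i, (MvPolynomial.X (fold (c i)) : MvPolynomial (Fin n) ℚ) =
        MvPolynomial.monomial (∑ i, Finsupp.single (fold (c i)) 1) 1 := by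
      rw [MvPolynomial.monomial_sum_one]
      rfl
    rw [this, MvPolynomial.coeff_monomial]
    refine if_congr ?_ rfl rfl
    rw [Finsupp.ext_iff]
    refine forall_congr' fun j => ?_
    simp only [Finsupp.finsetSum_apply, Finsupp.single_apply, Finset.sum_boole, Nat.cast_id,
      Finsupp.equivFunOnFinite_symm_apply_apply]
  simp only [h]
  rw [← Finset.sum_filter, Finset.sum_const, nsmul_eq_mul, mul_one]
  congr 2
  ext c
  simp [IsHalf, Fintype.mem_piFinset]

theorem sum_pos_le_inl (n : ℕ) (a : Fin n) :
    ∑ u ∈ Finset.univ.filter (fun u => pos u ≤ pos (.inl a)),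
      (MvPolynomial.X (fold u) : MvPolynomial (Fin n) ℚ) =
    tailSum n 0 - tailSum n (a + 1) := by
  rw [Finset.sum_filter, Fintype.sum_sum_type, tailSum, tailSum, ← Finset.sum_sub_distrib,
    ← Finset.sum_add_distrib]
  refine Finset.sum_congr rfl fun j _ => ?_
  rw [if_neg (show ¬ pos (.inr j) ≤ pos (.inl a) by simp only [pos]; omega),
    if_pos (Nat.zero_le _), add_zero]
  by_cases h : (j : ℕ) ≤ a
  · rw [if_pos (show pos (.inl j) ≤ pos (.inl a) from h), if_neg (by omega), sub_zero]
    rfl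
  · rw [if_neg (show ¬ pos (.inl j) ≤ pos (.inl a) from h), if_pos (by omega), sub_self]

theorem sum_pos_le_inr (n : ℕ) (a : Fin n) :
    ∑ u ∈ Finset.univ.filter (fun u => pos u ≤ pos (.inr a)),
      (MvPolynomial.X (fold u) : MvPolynomial (Fin n) ℚ) =
    tailSum n 0 + tailSum n a := by
  rw [Finset.sum_filter, Fintype.sum_sum_type, tailSum, tailSum]
  congr 1 <;> refine Finset.sum_congr rfl fun j _ => ?_
  · exact if_congr (by simp only [pos]; omega) rfl rfl
  · exact if_congr (by simp only [pos]; omega) rfl rfl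

theorem prod_sum_pos_le (n : ℕ) (hn : 1 ≤ n) :
    (∏ i : Fin n ⊕ Fin n, ∑ u ∈ Finset.univ.filter fun u => pos u ≤ pos i,
      (MvPolynomial.X (fold u) : MvPolynomial (Fin n) ℚ)) =
    2 * weightedEval (fun _ => 1) (tailSum n 0)
      (∏ a ∈ Finset.range n, (Polynomial.X ^ 2 - Polynomial.C (tailSum n (a + 1) ^ 2))) := by
  rw [Fintype.prod_sum_type]
  simp only [sum_pos_le_inl, sum_pos_le_inr]
  rw [Fin.prod_univ_eq_prod_range (fun a => tailSum n 0 - tailSum n (a + 1)),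
    Fin.prod_univ_eq_prod_range (fun a => tailSum n 0 + tailSum n a), weightedEval_one,
    Polynomial.eval_prod]
  have h : ∏ a ∈ Finset.range n, (tailSum n 0 + tailSum n a) =
      2 * ∏ a ∈ Finset.range n, (tailSum n 0 + tailSum n (a + 1)) := by
    obtain ⟨k, rfl⟩ : ∃ k, n = k + 1 := ⟨n - 1, by omega⟩
    rw [Finset.prod_range_succ', Finset.prod_range_succ _ k, tailSum_self]
    ring
  rw [h, mul_left_comm, ← Finset.prod_mul_distrib]
  congr 1
  refine Finset.prod_congr rfl fun a _ => ?_
  simp only [Polynomial.eval_sub, Polynomial.eval_pow, Polynomial.eval_X, Polynomial.eval_C]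
  ring

/-- `|SDC_{2n}| = 2 P_n(2)` for all `n ≥ 1`. -/
theorem statement4 (n : ℕ) (hn : 1 ≤ n) :
    ((SDCF (2*n)).card : ℚ) = 2 * (P n).eval 2 := by
  rw [card_SDCF, card_isHalf, prod_sum_pos_le n hn,
    show (2 : MvPolynomial (Fin n) ℚ) = MvPolynomial.C 2 from (map_ofNat _ 2).symm,
    MvPolynomial.coeff_C_mul, coeff_two_weightedEval]
  obtain ⟨k, rfl⟩ : ∃ k, n = k + 1 := ⟨n - 1, by omega⟩
  have := P_succ_eval k 2
  rw [Nat.cast_ofNat] at this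
  rw [this, Function.iterate_succ_apply', recStep]
  simp

end SymDellac
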